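/- arXiv:0811.2370 — 11 statements merged into one kernel-verified Lean document; each statement's English description precedes it below -/
import Mathlib

section
/- (Initial linearity box.) Let y, z ∈ PL₊^<(I), let α ∈ (0,1) and c ∈ (0,1) be such that y(t) = z(t) = c·t for all t ∈ [0,α], and let g ∈ PL₊(I) satisfy g⁻¹ ∘ y ∘ g = z. Then the graph of g is linear inside the box [0,α]×[0,α]: for every t ∈ [0,α] with g(t) ∈ [0,α], one has g(t) = g'(0)·t. -/
open Set

/-- `f` is piecewise linear on `[0,1]` with finitely many breakpoints:
there is a partition `0 = t₀ < t₁ < ⋯ < tₙ = 1` such that `f` is affine on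
each subinterval `[tᵢ, tᵢ₊₁]`. -/
def PiecewiseLinearOn (f : ℝ → ℝ) : Prop :=
  ∃ n : ℕ, ∃ t : Fin (n + 1) → ℝ, StrictMono t ∧ t 0 = 0 ∧ t (Fin.last n) = 1 ∧
    ∀ i : Fin n, ∃ a b : ℝ, ∀ x ∈ Icc (t i.castSucc) (t i.succ), f x = a * x + b

/-- The group `PL₊(I)` of orientation-preserving piecewise-linear homeomorphisms of
`I = [0,1]`, realized as the permutations of `ℝ` that fix every point outside `(0,1)`,
are strictly increasing, and are piecewise linear with finitely many breakpoints on `[0,1]`.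
(Composition/inverse are the group operations of `Equiv.Perm ℝ`: `(g * h) t = g (h t)`.) -/
def PLPlus (g : Equiv.Perm ℝ) : Prop :=
  StrictMono (⇑g) ∧ (∀ t : ℝ, t ∉ Ioo (0 : ℝ) 1 → g t = t) ∧ PiecewiseLinearOn ⇑g

/-- `PL₊^<(I)`: elements of `PL₊(I)` lying below the diagonal on `(0,1)`. -/
def PLPlusBelow (g : Equiv.Perm ℝ) : Prop :=
  PLPlus g ∧ ∀ t ∈ Ioo (0 : ℝ) 1, g t < t

/-- `PL₊^>(I)`: elements of `PL₊(I)` lying above the diagonal on `(0,1)`. -/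
def PLPlusAbove (g : Equiv.Perm ℝ) : Prop :=
  PLPlus g ∧ ∀ t ∈ Ioo (0 : ℝ) 1, t < g t

/-- `f` has initial slope `q`, i.e. `f t = q·t` for all sufficiently small `t ≥ 0`. -/
def InitialSlope (f : ℝ → ℝ) (q : ℝ) : Prop :=
  0 < q ∧ ∃ ε > (0 : ℝ), ∀ t ∈ Icc (0 : ℝ) ε, f t = q * t

/-- `f` has final slope `r`, i.e. `1 - f t = r·(1 - t)` for all `t` sufficiently close to `1`. -/
def FinalSlope (f : ℝ → ℝ) (r : ℝ) : Prop :=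
  0 < r ∧ ∃ δ > (0 : ℝ), ∀ t ∈ Icc (1 - δ) (1 : ℝ), 1 - f t = r * (1 - t)

/-- A map commuting with multiplication by `c ∈ [0,1]` inside the box `[0,α] × [0,α]` commutes
with multiplication by all powers of `c` there. -/
lemma apply_pow_mul_of_apply_mul {f : ℝ → ℝ} {α c : ℝ} (hc : c ∈ Icc (0 : ℝ) 1)
    (h : ∀ t ∈ Icc (0 : ℝ) α, f t ∈ Icc (0 : ℝ) α → f (c * t) = c * f t) (n : ℕ) :
    ∀ t ∈ Icc (0 : ℝ) α, f t ∈ Icc (0 : ℝ) α → f (c ^ n * t) = c ^ n * f t := by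
  induction n with
  | zero => simp
  | succ n ih =>
    intro t ht hft
    have hstep : ∀ s ∈ Icc (0 : ℝ) α, c * s ∈ Icc (0 : ℝ) α := fun s hs =>
      ⟨mul_nonneg hc.1 hs.1, (mul_le_of_le_one_left hs.1 hc.2).trans hs.2⟩
    have key := h t ht hft
    rw [pow_succ, mul_assoc, mul_assoc, ← key]
    exact ih _ (hstep t ht) (key ▸ hstep _ hft)

/-- initial linearity box: if `y(t) = z(t) = c·t` on `[0,α]` and
`g⁻¹ ∘ y ∘ g = z`, then the graph of `g` is linear inside the box `[0,α] × [0,α]`. -/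
theorem initial_linearity_box (y z g : Equiv.Perm ℝ) (α c q : ℝ)
    (hy : PLPlusBelow y) (hz : PLPlusBelow z) (hg : PLPlus g)
    (hα : α ∈ Ioo (0 : ℝ) 1) (hc : c ∈ Ioo (0 : ℝ) 1)
    (hlin : ∀ t ∈ Icc (0 : ℝ) α, y t = c * t ∧ z t = c * t)
    (hconj : g⁻¹ * y * g = z)
    (hq : InitialSlope (⇑g) q) :
    ∀ t ∈ Icc (0 : ℝ) α, g t ∈ Icc (0 : ℝ) α → g t = q * t := by
  intro t ht hgt
  obtain ⟨-, ε, hε, hslope⟩ := hq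
  have hcomm : ∀ s ∈ Icc (0 : ℝ) α, g s ∈ Icc (0 : ℝ) α → g (c * s) = c * g s := by
    intro s hs hgs
    rw [← (hlin s hs).2, ← (hlin _ hgs).1, ← hconj]
    simp
  have hlim : Filter.Tendsto (fun n : ℕ => c ^ n * t) Filter.atTop (nhds 0) := by
    simpa using (tendsto_pow_atTop_nhds_zero_of_lt_one hc.1.le hc.2).mul_const t
  obtain ⟨n, hn⟩ := (hlim.eventually_le_const hε).exists
  have hpow := apply_pow_mul_of_apply_mul (Ioo_subset_Icc_self hc) hcomm n t ht hgt
  rw [hslope _ ⟨mul_nonneg (pow_nonneg hc.1.le n) ht.1, hn⟩] at hpow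
  apply mul_left_cancel₀ (pow_pos hc.1 n).ne'
  linarith
end

section
/- (Final linearity box.) Let y, z ∈ PL₊^<(I), let β ∈ (0,1) and c > 1 be such that 1 − y(t) = 1 − z(t) = c·(1 − t) for all t ∈ [β,1], and let g ∈ PL₊(I) satisfy g⁻¹ ∘ y ∘ g = z. Then for every t ∈ [β,1] with g(t) ∈ [β,1], one has 1 − g(t) = g'(1)·(1 − t). -/
open Set

/-- A conjugator between two germs equal to `t ↦ 1 - c·(1 - t)` on `[β,1]` commutes with the
inverse contraction toward `1` inside the box `[β,1] × [β,1]`. -/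
theorem one_sub_apply_contraction {y z g : Equiv.Perm ℝ} {β c t : ℝ} (hc : 1 < c)
    (hlin : ∀ t ∈ Icc β (1 : ℝ), 1 - y t = c * (1 - t) ∧ 1 - z t = c * (1 - t))
    (hconj : g⁻¹ * y * g = z) (ht : t ∈ Icc β (1 : ℝ)) (hgt : g t ∈ Icc β (1 : ℝ)) :
    1 - g (1 - (1 - t) / c) = (1 - g t) / c := by
  have hc0 : 0 < c := by linarith
  have mem : ∀ x ∈ Icc β (1 : ℝ), 1 - (1 - x) / c ∈ Icc β (1 : ℝ) := by
    intro x hx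
    have h1 : (1 - x) / c ≤ 1 - x := div_le_self (by linarith [hx.2]) hc.le
    have h2 : 0 ≤ (1 - x) / c := div_nonneg (by linarith [hx.2]) hc0.le
    exact ⟨by linarith [hx.1], by linarith⟩
  have cancel : ∀ x : ℝ, c * (1 - (1 - (1 - x) / c)) = 1 - x := by
    intro x
    field_simp
    ring
  have hz : z (1 - (1 - t) / c) = t := by
    linarith [(hlin _ (mem t ht)).2, cancel t]
  have hy : y (1 - (1 - g t) / c) = g t := by
    linarith [(hlin _ (mem (g t) hgt)).1, cancel (g t)]
  have hyg : y (g (1 - (1 - t) / c)) = g (z (1 - (1 - t) / c)) := by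
    simp [← hconj]
  rw [hz, ← hy] at hyg
  rw [y.injective hyg]
  ring

/-- final linearity box: if `1 - y(t) = 1 - z(t) = c·(1-t)` on `[β,1]` and
`g⁻¹ ∘ y ∘ g = z`, then the graph of `g` is linear inside the box `[β,1] × [β,1]`. -/
theorem final_linearity_box (y z g : Equiv.Perm ℝ) (β c r : ℝ)
    (hy : PLPlusBelow y) (hz : PLPlusBelow z) (hg : PLPlus g)
    (hβ : β ∈ Ioo (0 : ℝ) 1) (hc : 1 < c)
    (hlin : ∀ t ∈ Icc β (1 : ℝ), 1 - y t = c * (1 - t) ∧ 1 - z t = c * (1 - t))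
    (hconj : g⁻¹ * y * g = z)
    (hr : FinalSlope (⇑g) r) :
    ∀ t ∈ Icc β (1 : ℝ), g t ∈ Icc β (1 : ℝ) → 1 - g t = r * (1 - t) := by
  intro t ht hgt
  have hc0 : 0 < c := by linarith
  have shrink : ∀ x ∈ Icc β (1 : ℝ), ∀ n : ℕ, 1 - (1 - x) / c ^ n ∈ Icc β (1 : ℝ) := by
    intro x hx n
    have h1 : (1 - x) / c ^ n ≤ 1 - x :=
      div_le_self (by linarith [hx.2]) (one_le_pow₀ hc.le)
    have h2 : 0 ≤ (1 - x) / c ^ n := div_nonneg (by linarith [hx.2]) (by positivity)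
    exact ⟨by linarith [hx.1], by linarith⟩
  have iter : ∀ n : ℕ, g (1 - (1 - t) / c ^ n) = 1 - (1 - g t) / c ^ n := by
    intro n
    induction n with
    | zero => simp
    | succ n ih =>
      have h := one_sub_apply_contraction hc hlin hconj (shrink t ht n)
        (ih ▸ shrink (g t) hgt n)
      rw [ih, sub_sub_cancel, sub_sub_cancel, div_div, div_div, ← pow_succ] at h
      linarith
  obtain ⟨-, δ, hδ, hlinear⟩ := hr
  obtain ⟨n, hn⟩ := pow_unbounded_of_one_lt ((1 - t) / δ) hc
  have hcn : 0 < c ^ n := by positivity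
  have hsmall : (1 - t) / c ^ n ≤ δ := by
    rw [div_lt_iff₀ hδ] at hn
    rw [div_le_iff₀ hcn]
    linarith
  have h := hlinear (1 - (1 - t) / c ^ n) ⟨by linarith, (shrink t ht n).2⟩
  rw [iter, sub_sub_cancel, sub_sub_cancel] at h
  field_simp at h
  exact h
end

section
/- (Identification trick, existence.) Let y, z ∈ PL₊^<(I) and let α ∈ (0,1) be such that y(t) = z(t) for all t ∈ [0,α]. Then there exists g ∈ PL₊(I) such that g(t) = t for all t ∈ [0,α] and y(g(t)) = g(z(t)) for all t ∈ [0, z⁻¹(α)] (note z⁻¹(α) > α since z lies below the diagonal). -/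
open Set

/-- A breakpoint-set form of piecewise linearity: `f` is affine on every subinterval of `[0,1]`
whose interior avoids the finite set `S`. -/
def AffineOff (f : ℝ → ℝ) (S : Finset ℝ) : Prop :=
  ∀ u v : ℝ, 0 ≤ u → u < v → v ≤ 1 → (∀ s ∈ S, s ∉ Ioo u v) →
    ∃ a b : ℝ, ∀ x ∈ Icc u v, f x = a * x + b

theorem PiecewiseLinearOn.exists_affineOff {f : ℝ → ℝ} (hf : PiecewiseLinearOn f) :
    ∃ S, AffineOff f S := by
  classical
  obtain ⟨n, t, ht, h0, h1, hlin⟩ := hf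
  refine ⟨Finset.univ.image t, fun u v hu huv hv hS => ?_⟩
  have hne : (Finset.univ.filter fun i => t i ≤ u).Nonempty := ⟨0, by simp [h0, hu]⟩
  obtain ⟨i, hi, hmax⟩ := Finset.exists_max_image _ id hne
  simp only [Finset.mem_filter, Finset.mem_univ, true_and, id] at hi hmax
  have hlast : i ≠ Fin.last n := by
    rintro rfl
    linarith
  obtain ⟨k, rfl⟩ := Fin.exists_castSucc_eq.2 hlast
  have hu' : u < t k.succ := by
    by_contra! h
    exact absurd (hmax _ h) (not_le.2 Fin.castSucc_lt_succ)
  have hv' : v ≤ t k.succ := by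
    by_contra! h
    exact hS _ (Finset.mem_image_of_mem _ (Finset.mem_univ _)) ⟨hu', h⟩
  obtain ⟨a, b, hab⟩ := hlin k
  exact ⟨a, b, fun x hx => hab x ⟨hi.trans hx.1, hx.2.trans hv'⟩⟩

theorem AffineOff.piecewiseLinearOn {f : ℝ → ℝ} {S : Finset ℝ} (hf : AffineOff f S) :
    PiecewiseLinearOn f := by
  classical
  let T : Finset ℝ := insert 0 (insert 1 (S.filter fun s => s ∈ Ioo (0 : ℝ) 1))
  have hT : ∀ x ∈ T, 0 ≤ x ∧ x ≤ 1 := by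
    intro x hx
    simp only [T, Finset.mem_insert, Finset.mem_filter, mem_Ioo] at hx
    rcases hx with rfl | rfl | ⟨-, h⟩
    · norm_num
    · norm_num
    · exact ⟨h.1.le, h.2.le⟩
  have h0T : (0 : ℝ) ∈ T := by simp [T]
  have h1T : (1 : ℝ) ∈ T := by simp [T]
  obtain ⟨n, hn⟩ := Nat.exists_eq_succ_of_ne_zero (Finset.card_ne_zero_of_mem h0T)
  let t := T.orderEmbOfFin hn
  have hsurj : ∀ x ∈ T, ∃ i, t i = x := by
    intro x hx
    have : x ∈ Set.range t := by
      rw [Finset.range_orderEmbOfFin]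
      exact hx
    exact this
  have hmem : ∀ i, 0 ≤ t i ∧ t i ≤ 1 := fun i => hT _ (T.orderEmbOfFin_mem hn i)
  refine ⟨n, t, t.strictMono, ?_, ?_, fun i => ?_⟩
  · obtain ⟨i, hi⟩ := hsurj 0 h0T
    exact le_antisymm (hi ▸ t.monotone (Fin.zero_le i)) (hmem _).1
  · obtain ⟨i, hi⟩ := hsurj 1 h1T
    exact le_antisymm (hmem _).2 (hi ▸ t.monotone (Fin.le_last i))
  · refine hf _ _ (hmem _).1 (t.strictMono Fin.castSucc_lt_succ) (hmem _).2 fun s hs hsI => ?_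
    have hsT : s ∈ T := by
      simp only [T, Finset.mem_insert, Finset.mem_filter, mem_Ioo]
      exact Or.inr (Or.inr ⟨hs, (hmem _).1.trans_lt hsI.1, hsI.2.trans_le (hmem _).2⟩)
    obtain ⟨j, rfl⟩ := hsurj s hsT
    have h1 := t.lt_iff_lt.1 hsI.1
    have h2 := t.lt_iff_lt.1 hsI.2
    simp only [Fin.lt_def, Fin.val_castSucc, Fin.val_succ] at h1 h2
    omega

theorem PLPlus.map_zero {g : Equiv.Perm ℝ} (hg : PLPlus g) : g 0 = 0 := hg.2.1 0 (by simp)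

theorem PLPlus.map_one {g : Equiv.Perm ℝ} (hg : PLPlus g) : g 1 = 1 := hg.2.1 1 (by simp)

theorem PLPlus.inv {g : Equiv.Perm ℝ} (hg : PLPlus g) : PLPlus g⁻¹ := by
  classical
  have hmono : StrictMono (⇑g⁻¹) := fun a b hab => by
    rw [← hg.1.lt_iff_lt]
    simpa using hab
  have hfix : ∀ t : ℝ, t ∉ Ioo (0 : ℝ) 1 → g⁻¹ t = t := fun t ht => by
    rw [Equiv.Perm.inv_eq_iff_eq, hg.2.1 t ht]
  obtain ⟨S, hS⟩ := hg.2.2.exists_affineOff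
  refine ⟨hmono, hfix, AffineOff.piecewiseLinearOn (S := S.image g) ?_⟩
  intro u v hu huv hv hsep
  have hu' : 0 ≤ g⁻¹ u := by
    simpa [hfix 0 (by simp)] using hmono.monotone hu
  have hv' : g⁻¹ v ≤ 1 := by
    simpa [hfix 1 (by simp)] using hmono.monotone hv
  obtain ⟨a, b, hab⟩ := hS (g⁻¹ u) (g⁻¹ v) hu' (hmono huv) hv' fun s hs hsI =>
    hsep (g s) (Finset.mem_image_of_mem _ hs)
      ⟨by simpa using hg.1 hsI.1, by simpa using hg.1 hsI.2⟩
  have key : ∀ x ∈ Icc u v, x = a * g⁻¹ x + b := fun x hx => by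
    simpa using hab (g⁻¹ x) ⟨hmono.monotone hx.1, hmono.monotone hx.2⟩
  have ha : a ≠ 0 := by
    rintro rfl
    linarith [key u ⟨le_rfl, huv.le⟩, key v ⟨huv.le, le_rfl⟩]
  refine ⟨a⁻¹, -(a⁻¹ * b), fun x hx => ?_⟩
  have := key x hx
  field_simp
  linarith

theorem PLPlus.mul {g h : Equiv.Perm ℝ} (hg : PLPlus g) (hh : PLPlus h) : PLPlus (g * h) := by
  classical
  obtain ⟨S, hS⟩ := hg.2.2.exists_affineOff
  obtain ⟨T, hT⟩ := hh.2.2.exists_affineOff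
  refine ⟨hg.1.comp hh.1, fun t ht => ?_,
    AffineOff.piecewiseLinearOn (S := T ∪ S.image ⇑h⁻¹) ?_⟩
  · rw [Equiv.Perm.mul_apply, hh.2.1 t ht, hg.2.1 t ht]
  intro u v hu huv hv hsep
  obtain ⟨c, d, hcd⟩ := hT u v hu huv hv fun s hs => hsep s (Finset.mem_union_left _ hs)
  obtain ⟨a, b, hab⟩ := hS (h u) (h v) (hh.map_zero ▸ hh.1.monotone hu) (hh.1 huv)
    (hh.map_one ▸ hh.1.monotone hv) fun s hs hsI =>
      hsep (h⁻¹ s) (Finset.mem_union_right _ (Finset.mem_image_of_mem _ hs))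
        ⟨hh.1.lt_iff_lt.1 (by simpa using hsI.1), hh.1.lt_iff_lt.1 (by simpa using hsI.2)⟩
  refine ⟨a * c, a * d + b, fun x hx => ?_⟩
  rw [Equiv.Perm.mul_apply, hab (h x) ⟨hh.1.monotone hx.1, hh.1.monotone hx.2⟩, hcd x hx]
  ring

/-- identification trick, existence: if `y = z` on `[0,α]`, then there is
`g ∈ PL₊(I)` which is the identity on `[0,α]` and conjugates `y` to `z` on `[0, z⁻¹(α)]`. -/
theorem identification_trick_existence (y z : Equiv.Perm ℝ) (α : ℝ)
    (hy : PLPlusBelow y) (hz : PLPlusBelow z)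
    (hα : α ∈ Ioo (0 : ℝ) 1)
    (heq : ∀ t ∈ Icc (0 : ℝ) α, y t = z t) :
    ∃ g : Equiv.Perm ℝ, PLPlus g ∧ (∀ t ∈ Icc (0 : ℝ) α, g t = t) ∧
      ∀ t ∈ Icc (0 : ℝ) (z⁻¹ α), y (g t) = g (z t) := by
  refine ⟨y⁻¹ * z, hy.1.inv.mul hz.1, fun t ht => ?_, fun t ht => ?_⟩
  · rw [Equiv.Perm.mul_apply, Equiv.Perm.inv_eq_iff_eq, heq t ht]
  · have hzt : z t ∈ Icc (0 : ℝ) α :=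
      ⟨hz.1.map_zero ▸ hz.1.1.monotone ht.1, by simpa using hz.1.1.monotone ht.2⟩
    simp [Equiv.Perm.mul_apply, ← heq _ hzt]
end

section
/- (Uniqueness of conjugators.) Let y, z ∈ PL₊^<(I) and let q be a positive real number. There exists at most one g ∈ PL₊(I) such that g⁻¹ ∘ y ∘ g = z and g'(0) = q. Equivalently, if g₁, g₂ ∈ PL₊(I) both conjugate y to z and g₁'(0) = g₂'(0), then g₁ = g₂. -/
open Set

/-- The forward orbit of a positive point stays positive. -/
theorem PLPlus.pow_apply_pos {g : Equiv.Perm ℝ} (hg : PLPlus g) {t : ℝ} (ht : 0 < t) (n : ℕ) :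
    0 < (g ^ n) t := by
  induction n with
  | zero => simpa using ht
  | succ n ih =>
    rw [pow_succ', Equiv.Perm.mul_apply]
    simpa only [hg.map_zero] using hg.1 ih

/-- Forward orbits of a map lying below the diagonal come arbitrarily close to `0`. -/
theorem PLPlusBelow.exists_pow_apply_le {z : Equiv.Perm ℝ} (hz : PLPlusBelow z) {t ε : ℝ}
    (ht : t < 1) (hε : 0 < ε) : ∃ n : ℕ, (z ^ n) t ≤ ε := by
  by_contra! h
  have hbdd : BddBelow (range fun n : ℕ => (z ^ n) t) :=
    ⟨ε, by rintro _ ⟨n, rfl⟩; exact (h n).le⟩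
  set L := ⨅ n : ℕ, (z ^ n) t with hL
  have hL0 : 0 < L := hε.trans_le (le_ciInf fun n => (h n).le)
  have hL1 : L < 1 := lt_of_le_of_lt (by simpa using ciInf_le hbdd 0) ht
  have hlt : L < z⁻¹ L := by
    rw [← hz.1.1.lt_iff_lt, ← Equiv.Perm.mul_apply, mul_inv_cancel, Equiv.Perm.one_apply]
    exact hz.2 L ⟨hL0, hL1⟩
  obtain ⟨n, hn⟩ := exists_lt_of_ciInf_lt (hL ▸ hlt)
  have hn' := hz.1.1 hn
  simp only [← Equiv.Perm.mul_apply, ← pow_succ', mul_inv_cancel, Equiv.Perm.one_apply] at hn'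
  exact absurd hn' (not_lt.mpr (ciInf_le hbdd (n + 1)))

/-- uniqueness of conjugators: two conjugators of `y` to `z` with the same
initial slope coincide. -/
theorem uniqueness_of_conjugators (y z g₁ g₂ : Equiv.Perm ℝ) (q : ℝ)
    (hy : PLPlusBelow y) (hz : PLPlusBelow z)
    (hg₁ : PLPlus g₁) (hg₂ : PLPlus g₂)
    (hq : 0 < q)
    (hc₁ : g₁⁻¹ * y * g₁ = z) (hc₂ : g₂⁻¹ * y * g₂ = z)
    (hs₁ : InitialSlope (⇑g₁) q) (hs₂ : InitialSlope (⇑g₂) q) :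
    g₁ = g₂ := by
  obtain ⟨-, ε₁, hε₁, h₁⟩ := hs₁
  obtain ⟨-, ε₂, hε₂, h₂⟩ := hs₂
  ext t
  by_cases ht : t ∈ Ioo (0 : ℝ) 1
  · obtain ⟨n, hn⟩ := hz.exists_pow_apply_le ht.2 (lt_min hε₁ hε₂)
    have hpos := (hz.1.pow_apply_pos ht.1 n).le
    have heq : g₁ ((z ^ n) t) = g₂ ((z ^ n) t) := by
      rw [h₁ _ ⟨hpos, hn.trans (min_le_left _ _)⟩, h₂ _ ⟨hpos, hn.trans (min_le_right _ _)⟩]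
    have conj_pow : ∀ g : Equiv.Perm ℝ, g⁻¹ * y * g = z → g * z ^ n = y ^ n * g := by
      intro g hg
      have h : SemiconjBy g z y := by
        rw [SemiconjBy, ← hg]
        group
      exact h.pow_right n
    simp only [← Equiv.Perm.mul_apply] at heq
    rw [conj_pow g₁ hc₁, conj_pow g₂ hc₂] at heq
    exact (y ^ n).injective heq
  · rw [hg₁.2.1 t ht, hg₂.2.1 t ht]
end

section
/- Let y ∈ PL₊^<(I) and let g ∈ PL₊(I) commute with y, i.e. g ∘ y = y ∘ g. If there exists α ∈ (0,1) such that g(t) = t for all t ∈ [0,α], then g is the identity map on [0,1]. -/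
open Set

/-- an element of `PL₊(I)` commuting with some `y ∈ PL₊^<(I)` and equal to
the identity on some interval `[0,α]` with `α ∈ (0,1)` is the identity on `[0,1]`. -/
theorem commuting_identity_near_zero (y g : Equiv.Perm ℝ) (α : ℝ)
    (hy : PLPlusBelow y) (hg : PLPlus g)
    (hcomm : g * y = y * g)
    (hα : α ∈ Ioo (0 : ℝ) 1)
    (hid : ∀ t ∈ Icc (0 : ℝ) α, g t = t) :
    ∀ t ∈ Icc (0 : ℝ) 1, g t = t := by
  obtain ⟨⟨hmono, hfix, -⟩, hbelow⟩ := hy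
  by_contra! h
  obtain ⟨u, hu, hgu⟩ := h
  set B : Set ℝ := {t | t ∈ Icc (0 : ℝ) 1 ∧ g t ≠ t}
  have hB : ∀ t ∈ B, α ≤ t := fun t ht ↦ by
    by_contra! hlt
    exact ht.2 (hid t ⟨ht.1.1, hlt.le⟩)
  have hne : B.Nonempty := ⟨u, hu, hgu⟩
  have hu1 : u < 1 := lt_of_le_of_ne hu.2 fun h ↦ hgu (hg.2.1 u (by simp [h]))
  have hinv : ∀ t ∈ B, y t ∈ B := fun t ht ↦ by
    refine ⟨⟨?_, ?_⟩, fun h ↦ ht.2 (y.injective ?_)⟩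
    · simpa [hfix 0 (by simp)] using hmono.monotone ht.1.1
    · simpa [hfix 1 (by simp)] using hmono.monotone ht.1.2
    · rw [← h]
      exact (DFunLike.congr_fun hcomm t).symm
  have hbdd : BddBelow B := ⟨α, hB⟩
  have hc : sInf B ∈ Ioo (0 : ℝ) 1 :=
    ⟨hα.1.trans_le (le_csInf hne hB), (csInf_le hbdd ⟨hu, hgu⟩).trans_lt hu1⟩
  have hlt : sInf B < y.symm (sInf B) := by
    rw [← hmono.lt_iff_lt, y.apply_symm_apply]
    exact hbelow _ hc
  obtain ⟨t, ht, htlt⟩ := exists_lt_of_csInf_lt hne hlt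
  have hyt := hmono htlt
  rw [y.apply_symm_apply] at hyt
  exact (csInf_le hbdd (hinv t ht)).not_gt hyt
end

section
/- Let z be a one-bump function (z ∈ PL₊^<(I) or z ∈ PL₊^>(I)) and let g ∈ PL₊(I) commute with z, i.e. g ∘ z = z ∘ g. If the initial slope of g equals 1, i.e. g'(0) = 1, then g is the identity map on [0,1]. -/
open Set

/-- A strictly increasing permutation of `ℝ` fixing `0` and lying below the diagonal on `(0,1)`
moves every point of `(0,1)` arbitrarily close to `0` under iteration. -/
theorem exists_iterate_lt_of_below_diagonal {w : Equiv.Perm ℝ} (hw : StrictMono w)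
    (h0 : w 0 = 0) (hlt : ∀ t ∈ Ioo (0 : ℝ) 1, w t < t) {t : ℝ} (ht : t ∈ Ioo (0 : ℝ) 1)
    {ε : ℝ} (hε : 0 < ε) : ∃ n : ℕ, w^[n] t ∈ Ioo 0 ε := by
  have hmem : ∀ n : ℕ, w^[n] t ∈ Ioo (0 : ℝ) 1 := by
    intro n
    induction n with
    | zero => exact ht
    | succ n ih =>
      rw [Function.iterate_succ_apply']
      exact ⟨h0 ▸ hw ih.1, (hlt _ ih).trans ih.2⟩
  have hanti : Antitone fun n : ℕ => w^[n] t := by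
    refine antitone_nat_of_succ_le fun n => ?_
    rw [Function.iterate_succ_apply']
    exact (hlt _ (hmem n)).le
  have hbdd : BddBelow (range fun n : ℕ => w^[n] t) :=
    ⟨0, by rintro _ ⟨n, rfl⟩; exact (hmem n).1.le⟩
  have hlim := tendsto_atTop_ciInf hanti hbdd
  have hfix := isFixedPt_of_tendsto_iterate hlim
    (hw.monotone.continuous_of_surjective w.surjective).continuousAt
  have hnonneg : 0 ≤ ⨅ n : ℕ, w^[n] t := le_ciInf fun n => (hmem n).1.le
  have hlt_one : ⨅ n : ℕ, w^[n] t < 1 := (ciInf_le hbdd 0).trans_lt (hmem 0).2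
  have hzero : ⨅ n : ℕ, w^[n] t = 0 := by
    by_contra hne
    exact (hlt _ ⟨lt_of_le_of_ne hnonneg (Ne.symm hne), hlt_one⟩).ne hfix
  rw [hzero] at hlim
  obtain ⟨n, hn⟩ := (hlim.eventually (gt_mem_nhds hε)).exists
  exact ⟨n, (hmem n).1, hn⟩

/-- A permutation of `ℝ` that is the identity near `0` on the right and commutes with a strictly
increasing permutation lying below the diagonal on `(0,1)` is the identity on `(0,1)`. -/
theorem eq_of_commute_of_below_diagonal {w g : Equiv.Perm ℝ} (hw : StrictMono w)
    (h0 : w 0 = 0) (hlt : ∀ t ∈ Ioo (0 : ℝ) 1, w t < t) (hcomm : Commute g w)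
    {ε : ℝ} (hε : 0 < ε) (hg : ∀ t ∈ Ioo 0 ε, g t = t) {t : ℝ} (ht : t ∈ Ioo (0 : ℝ) 1) :
    g t = t := by
  obtain ⟨n, hn⟩ := exists_iterate_lt_of_below_diagonal hw h0 hlt ht hε
  have hc : Function.Commute g w := fun x => DFunLike.congr_fun hcomm.eq x
  apply w.injective.iterate n
  rw [← (hc.iterate_right n).eq t, hg _ hn]

/-- an element of `PL₊(I)` commuting with a one-bump function and with
initial slope `1` is the identity on `[0,1]`. -/
theorem commuting_initial_slope_one (z g : Equiv.Perm ℝ)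
    (hz : PLPlusBelow z ∨ PLPlusAbove z) (hg : PLPlus g)
    (hcomm : g * z = z * g)
    (hs : InitialSlope (⇑g) 1) :
    ∀ t ∈ Icc (0 : ℝ) 1, g t = t := by
  obtain ⟨-, ε, hε, hgε⟩ := hs
  have hgε' : ∀ t ∈ Ioo 0 ε, g t = t := fun t ht => by
    rw [hgε t (Ioo_subset_Icc_self ht), one_mul]
  have hc : Commute g z := hcomm
  intro t _
  by_cases ht : t ∈ Ioo (0 : ℝ) 1
  · rcases hz with ⟨⟨hmono, hfix, -⟩, hlt⟩ | ⟨⟨hmono, hfix, -⟩, hgt⟩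
    · exact eq_of_commute_of_below_diagonal hmono (hfix 0 (by simp)) hlt hc hε hgε' ht
    · have hz_inv : ∀ x, z (z⁻¹ x) = x := z.apply_symm_apply
      refine eq_of_commute_of_below_diagonal (w := z⁻¹) (fun x y hxy => ?_) ?_ (fun x hx => ?_)
        hc.inv_right hε hgε' ht
      · rwa [← hmono.lt_iff_lt, hz_inv, hz_inv]
      · apply z.injective
        rw [hz_inv, hfix 0 (by simp)]
      · rw [← hmono.lt_iff_lt, hz_inv]
        exact hgt x hx
  · exact hg.2.1 t ht
end

section
/- (Conjugator for powers.) Let y, z ∈ PL₊^<(I), let g ∈ PL₊(I), and let n ≥ 1 be a natural number. Then g⁻¹ ∘ y ∘ g = z if and only if g⁻¹ ∘ yⁿ ∘ g = zⁿ, where yⁿ and zⁿ denote the n-fold compositional powers. -/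
open Set

theorem PLPlus.initialSlope {f : Equiv.Perm ℝ} (hf : PLPlus f) : ∃ q, InitialSlope f q := by
  obtain ⟨hmono, hfix, n, t, ht, ht0, ht1, hlin⟩ := hf
  have h0 : f 0 = 0 := hfix 0 (by simp)
  obtain _ | m := n
  · rw [Fin.last_zero, ht0] at ht1
    norm_num at ht1
  obtain ⟨a, b, hab⟩ := hlin 0
  have hpos : 0 < t (Fin.succ 0) := by
    rw [← ht0]
    exact ht (Fin.succ_pos 0)
  rw [Fin.castSucc_zero, ht0] at hab
  have hb : b = 0 := by
    have := hab 0 ⟨le_rfl, hpos.le⟩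
    linarith
  have hlin' : ∀ x ∈ Icc 0 (t (Fin.succ 0)), f x = a * x := fun x hx => by
    rw [hab x hx, hb, add_zero]
  refine ⟨a, ?_, t (Fin.succ 0), hpos, hlin'⟩
  have h := hmono hpos
  rw [h0, hlin' _ ⟨hpos.le, le_rfl⟩] at h
  exact pos_of_mul_pos_left h hpos.le

theorem PLPlus.pos {f : Equiv.Perm ℝ} (hf : PLPlus f) {x : ℝ} (hx : 0 < x) : 0 < f x := by
  simpa [hf.2.1 0 (by simp)] using hf.1 hx

theorem PLPlusBelow.apply_le {f : Equiv.Perm ℝ} (hf : PLPlusBelow f) (x : ℝ) : f x ≤ x := by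
  by_cases hx : x ∈ Ioo (0 : ℝ) 1
  · exact (hf.2 x hx).le
  · exact (hf.1.2.1 x hx).le

theorem PLPlusBelow.pow_apply_le {f : Equiv.Perm ℝ} (hf : PLPlusBelow f) (k : ℕ) (x : ℝ) :
    (f ^ k) x ≤ x := by
  induction k with
  | zero => simp
  | succ k ih =>
    rw [pow_succ', Equiv.Perm.mul_apply]
    exact (hf.apply_le _).trans ih

theorem PLPlus.pow_apply_pos_s8 {f : Equiv.Perm ℝ} (hf : PLPlus f) (k : ℕ) {x : ℝ} (hx : 0 < x) :
    0 < (f ^ k) x := by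
  induction k with
  | zero => simpa
  | succ k ih =>
    rw [pow_succ', Equiv.Perm.mul_apply]
    exact hf.pos ih

/-- Near `0`, powers of a map below the diagonal are multiplication by powers of its slope. -/
theorem PLPlusBelow.pow_apply_eq {f : Equiv.Perm ℝ} (hf : PLPlusBelow f) {a ε : ℝ}
    (h : ∀ t ∈ Icc (0 : ℝ) ε, f t = a * t) (k : ℕ) {x : ℝ} (hx : 0 < x) (hxε : x ≤ ε) :
    (f ^ k) x = a ^ k * x := by
  induction k with
  | zero => simp
  | succ k ih =>
    rw [pow_succ', Equiv.Perm.mul_apply,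
      h _ ⟨(hf.1.pow_apply_pos_s8 k hx).le, (hf.pow_apply_le k x).trans hxε⟩, ih]
    ring

/-- Orbits in `(0,1)` of a map below the diagonal accumulate at `0`. -/
theorem PLPlusBelow.exists_pow_apply_lt {f : Equiv.Perm ℝ} (hf : PLPlusBelow f) {x ε : ℝ}
    (hx : x ∈ Ioo (0 : ℝ) 1) (hε : 0 < ε) : ∃ k : ℕ, (f ^ k) x < ε := by
  by_contra! hge
  let S : Set ℝ := Set.range fun k : ℕ => (f ^ k) x
  have hbdd : BddBelow S := ⟨ε, by rintro _ ⟨k, rfl⟩; exact hge k⟩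
  have hne : S.Nonempty := Set.range_nonempty _
  have hL0 : 0 < sInf S := hε.trans_le (le_csInf hne (by rintro _ ⟨k, rfl⟩; exact hge k))
  have hL1 : sInf S < 1 := (csInf_le hbdd ⟨0, by simp⟩ : sInf S ≤ x).trans_lt hx.2
  have hlt : sInf S < f.symm (sInf S) := by
    rw [← hf.1.1.lt_iff_lt, Equiv.apply_symm_apply]
    exact hf.2 _ ⟨hL0, hL1⟩
  obtain ⟨_, ⟨k, rfl⟩, hk⟩ := exists_lt_of_csInf_lt hne hlt
  have hk' := hf.1.1 hk
  rw [Equiv.apply_symm_apply, ← Equiv.Perm.mul_apply, ← pow_succ'] at hk'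
  exact hk'.not_ge (csInf_le hbdd ⟨k + 1, rfl⟩)

/-- If `g` conjugates `yⁿ` to `zⁿ`, then it conjugates `y` to `z` on a neighbourhood of `0`. -/
theorem exists_conj_eq_near_zero {y z g : Equiv.Perm ℝ} {n : ℕ} (hn : n ≠ 0)
    (hy : PLPlusBelow y) (hz : PLPlusBelow z) (hg : PLPlus g)
    (h : SemiconjBy g (z ^ n) (y ^ n)) :
    ∃ δ > (0 : ℝ), ∀ x, 0 < x → x ≤ δ → g (z x) = y (g x) := by
  obtain ⟨a, ha, εy, hεy, hya⟩ := hy.1.initialSlope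
  obtain ⟨b, hb, εz, hεz, hzb⟩ := hz.1.initialSlope
  obtain ⟨c, hc, εg, hεg, hgc⟩ := hg.initialSlope
  let δ := min (min εz εg) (εy / c)
  have hδ : 0 < δ := by positivity
  have hgy : ∀ x, 0 < x → x ≤ δ → x ≤ εz ∧ g x = c * x ∧ c * x ≤ εy := fun x hx hxδ => by
    obtain ⟨⟨hxz, hxg⟩, hxy⟩ : (x ≤ εz ∧ x ≤ εg) ∧ x ≤ εy / c := by
      simpa only [δ, le_min_iff] using hxδ
    refine ⟨hxz, hgc x ⟨hx.le, hxg⟩, ?_⟩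
    rwa [le_div_iff₀' hc] at hxy
  have hab : b = a := by
    obtain ⟨hδz, hδg, hδy⟩ := hgy δ hδ le_rfl
    have heq : g ((z ^ n) δ) = (y ^ n) (g δ) := DFunLike.congr_fun h.eq δ
    rw [(hgy _ (hz.1.pow_apply_pos_s8 n hδ) (hz.pow_apply_le n δ)).2.1, hz.pow_apply_eq hzb n hδ hδz,
      hδg, hy.pow_apply_eq hya n (mul_pos hc hδ) hδy, mul_left_comm] at heq
    exact (pow_left_inj₀ hb.le ha.le hn).1 (mul_right_cancel₀ (mul_pos hc hδ).ne' heq)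
  refine ⟨δ, hδ, fun x hx hxδ => ?_⟩
  obtain ⟨hxz, hxg, hxy⟩ := hgy x hx hxδ
  rw [(hgy _ (hz.1.pos hx) ((hz.apply_le x).trans hxδ)).2.1, hzb x ⟨hx.le, hxz⟩, hxg,
    hya _ ⟨(mul_pos hc hx).le, hxy⟩, hab, mul_left_comm]

theorem semiconjBy_of_pow {y z g : Equiv.Perm ℝ} {n : ℕ} (hn : n ≠ 0)
    (hy : PLPlusBelow y) (hz : PLPlusBelow z) (hg : PLPlus g)
    (h : SemiconjBy g (z ^ n) (y ^ n)) : SemiconjBy g z y := by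
  obtain ⟨δ, hδ, hnear⟩ := exists_conj_eq_near_zero hn hy hz hg h
  refine Equiv.ext fun x => ?_
  change g (z x) = y (g x)
  by_cases hx : x ∈ Ioo (0 : ℝ) 1
  · obtain ⟨k, hk⟩ := hz.exists_pow_apply_lt hx hδ
    have hle : ((z ^ n) ^ k) x ≤ δ := by
      obtain ⟨m, rfl⟩ := Nat.exists_eq_succ_of_ne_zero hn
      rw [← pow_mul, Nat.succ_mul, pow_add, Equiv.Perm.mul_apply]
      exact (hz.pow_apply_le _ _).trans hk.le
    have hpos : 0 < ((z ^ n) ^ k) x := by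
      rw [← pow_mul]
      exact hz.1.pow_apply_pos_s8 _ hx.1
    have hpow : ∀ t, g (((z ^ n) ^ k) t) = ((y ^ n) ^ k) (g t) :=
      fun t => DFunLike.congr_fun (h.pow_right k).eq t
    have hzc : z (((z ^ n) ^ k) x) = ((z ^ n) ^ k) (z x) :=
      DFunLike.congr_fun (((Commute.refl z).pow_right n).pow_right k).eq x
    have hyc : y (((y ^ n) ^ k) (g x)) = ((y ^ n) ^ k) (y (g x)) :=
      DFunLike.congr_fun (((Commute.refl y).pow_right n).pow_right k).eq (g x)
    have heq := hnear _ hpos hle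
    rw [hzc, hpow, hpow, hyc] at heq
    exact ((y ^ n) ^ k).injective heq
  · have hgx := hg.2.1 x hx
    rw [hz.1.2.1 x hx, hgx, hy.1.2.1 x hx]

/-- conjugator for powers: `g⁻¹ ∘ y ∘ g = z` iff `g⁻¹ ∘ yⁿ ∘ g = zⁿ`
for any `n ≥ 1`. -/
theorem conjugator_for_powers (y z g : Equiv.Perm ℝ) (n : ℕ) (hn : 1 ≤ n)
    (hy : PLPlusBelow y) (hz : PLPlusBelow z) (hg : PLPlus g) :
    g⁻¹ * y * g = z ↔ g⁻¹ * y ^ n * g = z ^ n := by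
  have hconj : ∀ u v : Equiv.Perm ℝ, g⁻¹ * u * g = v ↔ SemiconjBy g v u := fun u v => by
    rw [mul_assoc, inv_mul_eq_iff_eq_mul, SemiconjBy, eq_comm]
  rw [hconj, hconj]
  exact ⟨fun h => h.pow_right n, semiconjBy_of_pow (by omega) hy hz hg⟩
end

section
/- (Stair algorithm formula.) Let y, z ∈ PL₊^<(I), let α ∈ (0,1) and c ∈ (0,1) be such that y(t) = z(t) = c·t for all t ∈ [0,α], and let g ∈ PL₊(I) satisfy g⁻¹ ∘ y ∘ g = z with initial slope g'(0) = q ∈ (0,1). Then for every natural number N and every t ∈ [0,1] with z^N(t) ≤ α, one has g(t) = y^{-N}( q · z^N(t) ), where z^N is the N-fold composition of z and y^{-N} the N-fold composition of y⁻¹. -/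
open Set

/-- If `g` intertwines `z` with an injective `y`, both equal to `t ↦ c * t` on `[0, α]`, and `g` is
`t ↦ q * t` near `0` with `q < 1`, then `g` is `t ↦ q * t` on all of `[0, α]`. -/
theorem eq_mul_on_Icc_of_semiconj {y z g : ℝ → ℝ} {α c q ε : ℝ} (hy : Function.Injective y)
    (hc : c ∈ Ioo (0 : ℝ) 1) (hq : q ∈ Ioo (0 : ℝ) 1)
    (hlin : ∀ t ∈ Icc (0 : ℝ) α, y t = c * t ∧ z t = c * t)
    (hsemi : Function.Semiconj g z y) (hε : 0 < ε) (hg : ∀ t ∈ Icc (0 : ℝ) ε, g t = q * t) :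
    ∀ s ∈ Icc (0 : ℝ) α, g s = q * s := by
  have key : ∀ n : ℕ, ∀ s ∈ Icc (0 : ℝ) α, c ^ n * s ≤ ε → g s = q * s := by
    intro n
    induction n with
    | zero => intro s hs h; exact hg s ⟨hs.1, by simpa using h⟩
    | succ n ih =>
      intro s hs h
      have hcs : c * s ∈ Icc (0 : ℝ) α :=
        ⟨mul_nonneg hc.1.le hs.1, (mul_le_of_le_one_left hs.1 hc.2.le).trans hs.2⟩
      have hqs : q * s ∈ Icc (0 : ℝ) α :=
        ⟨mul_nonneg hq.1.le hs.1, (mul_le_of_le_one_left hs.1 hq.2.le).trans hs.2⟩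
      have hstep := ih (c * s) hcs (by rwa [← mul_assoc, ← pow_succ])
      apply hy
      rw [← hsemi s, (hlin s hs).2, hstep, (hlin _ hqs).1]
      ring
  intro s hs
  have hlim : Filter.Tendsto (fun n : ℕ => c ^ n * s) Filter.atTop (nhds 0) := by
    simpa using (tendsto_pow_atTop_nhds_zero_of_lt_one hc.1.le hc.2).mul_const s
  obtain ⟨n, hn⟩ := (hlim.eventually (gt_mem_nhds hε)).exists
  exact key n s hs hn.le

/-- stair algorithm formula: if `g` conjugates `y` to `z`, both equal to
`t ↦ c·t` on `[0,α]`, and `g` has initial slope `q ∈ (0,1)`, then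
`g(t) = y^{-N}(q · z^N(t))` whenever `z^N(t) ≤ α`. -/
theorem stair_algorithm_formula (y z g : Equiv.Perm ℝ) (α c q : ℝ)
    (hy : PLPlusBelow y) (hz : PLPlusBelow z) (hg : PLPlus g)
    (hα : α ∈ Ioo (0 : ℝ) 1) (hc : c ∈ Ioo (0 : ℝ) 1) (hq : q ∈ Ioo (0 : ℝ) 1)
    (hlin : ∀ t ∈ Icc (0 : ℝ) α, y t = c * t ∧ z t = c * t)
    (hconj : g⁻¹ * y * g = z)
    (hslope : InitialSlope (⇑g) q) :
    ∀ N : ℕ, ∀ t ∈ Icc (0 : ℝ) 1, (z ^ N) t ≤ α →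
      g t = (y⁻¹ ^ N) (q * (z ^ N) t) := by
  obtain ⟨-, ε, hε, hgε⟩ := hslope
  have hsemi : Function.Semiconj g z y := fun t => by
    simp [← hconj, Equiv.Perm.mul_apply]
  have hlinear := eq_mul_on_Icc_of_semiconj y.injective hc hq hlin hsemi hε hgε
  have hz0 : z 0 = 0 := hz.1.2.1 0 (by simp)
  intro N t ht hN
  have hnonneg : 0 ≤ (z ^ N) t := by
    rw [← Equiv.Perm.iterate_eq_pow]
    calc (0 : ℝ) = z^[N] 0 := (Function.iterate_fixed hz0 N).symm
      _ ≤ z^[N] t := hz.1.1.monotone.iterate N ht.1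
  have hpow : g ((z ^ N) t) = (y ^ N) (g t) := by
    simpa only [Equiv.Perm.iterate_eq_pow] using hsemi.iterate_right N t
  rw [← hlinear _ ⟨hnonneg, hN⟩, hpow, inv_pow, ← Equiv.Perm.mul_apply, inv_mul_cancel, Equiv.Perm.one_apply]
end

section
/- (Stair algorithm, conjugacy criterion.) Let y, z ∈ PL₊^<(I), let α, c ∈ (0,1) with y(t) = z(t) = c·t for all t ∈ [0,α], let β ∈ (0,1) and c' > 1 with 1 − y(t) = 1 − z(t) = c'·(1 − t) for all t ∈ [β,1], and let q ∈ (0,1). Choose any natural number N large enough that z^{-N}(α) > β and y^{-N}(q·α) > β. Define g : [0,1] → [0,1] by g(t) = y^{-N}(q·z^N(t)) for t ∈ [0, z^{-N}(α)], and g affine on [z^{-N}(α), 1] with g(1) = 1 (so g is the line from (z^{-N}(α), y^{-N}(q·α)) to (1,1) there). Then there exists a conjugator h ∈ PL₊(I) with h⁻¹ ∘ y ∘ h = z and h'(0) = q if and only if g ∘ z = y ∘ g; and in that case h = g. -/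
open Set

/-- The increasing permutations of `ℝ` that are affine on every interval whose interior misses
some fixed finite set of breakpoints. -/
def finitaryPLGroup : Subgroup (Equiv.Perm ℝ) where
  carrier := {e | StrictMono e ∧ ∃ S : Set ℝ, S.Finite ∧ ∀ a b, Disjoint (Ioo a b) S →
    ∃ m k : ℝ, ∀ x ∈ Icc a b, e x = m * x + k}
  one_mem' := ⟨strictMono_id, ∅, finite_empty, fun a b _ => ⟨1, 0, fun x _ => by simp⟩⟩
  mul_mem' := by
    rintro e f ⟨he, S, hS, hSe⟩ ⟨hf, T, hT, hTf⟩
    refine ⟨he.comp hf, T ∪ f ⁻¹' S, hT.union (hS.preimage f.injective.injOn), ?_⟩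
    intro a b hab
    rw [disjoint_union_right] at hab
    obtain ⟨m, k, hm⟩ := hTf a b hab.1
    obtain ⟨m', k', hm'⟩ := hSe (f a) (f b) (by
      rw [Set.disjoint_left] at hab ⊢
      rintro x ⟨hx1, hx2⟩ hxS
      obtain ⟨w, rfl⟩ := f.surjective x
      exact hab.2.le_bot ⟨⟨hf.lt_iff_lt.1 hx1, hf.lt_iff_lt.1 hx2⟩, hxS⟩)
    refine ⟨m' * m, m' * k + k', fun x hx => ?_⟩
    rw [Equiv.Perm.mul_apply, hm' (f x) ⟨hf.monotone hx.1, hf.monotone hx.2⟩, hm x hx]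
    ring
  inv_mem' := by
    rintro e ⟨he, S, hS, hSe⟩
    have happ : ∀ w, e (e⁻¹ w) = w := e.apply_symm_apply
    have hinv : StrictMono (e⁻¹ : Equiv.Perm ℝ) := fun a b hab => by
      rw [← he.lt_iff_lt]; simpa using hab
    refine ⟨hinv, e '' S, hS.image e, fun a b hab => ?_⟩
    obtain ⟨m, k, hm⟩ := hSe (e⁻¹ a) (e⁻¹ b) (by
      rw [Set.disjoint_left] at hab ⊢
      rintro x ⟨hx1, hx2⟩ hxS
      refine hab ⟨?_, ?_⟩ (mem_image_of_mem e hxS)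
      · simpa using he hx1
      · simpa using he hx2)
    rcases lt_or_ge a b with hlt | hle
    · have ha := hm (e⁻¹ a) ⟨le_rfl, (hinv hlt).le⟩
      have hb := hm (e⁻¹ b) ⟨(hinv hlt).le, le_rfl⟩
      rw [happ] at ha hb
      have hm0 : m ≠ 0 := by
        rintro rfl
        linarith
      refine ⟨m⁻¹, -(m⁻¹ * k), fun x hx => ?_⟩
      have hx' := hm (e⁻¹ x) ⟨hinv.monotone hx.1, hinv.monotone hx.2⟩
      rw [happ] at hx'
      rw [eq_comm] at hx'
      field_simp
      linarith
    · refine ⟨0, e⁻¹ a, fun x hx => ?_⟩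
      rw [le_antisymm (hx.2.trans hle) hx.1]
      ring

theorem exists_mem_finitaryPLGroup_affine (r k : ℝ) (hr : 0 < r) :
    ∃ e ∈ finitaryPLGroup, ∀ x, e x = r * x + k := by
  refine ⟨⟨fun x => r * x + k, fun x => (x - k) / r, fun x => ?_, fun x => ?_⟩, ⟨?_, ∅,
    finite_empty, fun a b _ => ⟨r, k, fun x _ => rfl⟩⟩, fun x => rfl⟩
  · field_simp
    ring
  · field_simp
    ring
  · intro a b hab
    simpa using mul_lt_mul_of_pos_left hab hr

/-- Two elements of `finitaryPLGroup` agreeing at `p` can be glued at `p`. -/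
theorem exists_mem_finitaryPLGroup_glue {e f : Equiv.Perm ℝ} (he : e ∈ finitaryPLGroup)
    (hf : f ∈ finitaryPLGroup) {p : ℝ} (hp : e p = f p) :
    ∃ h ∈ finitaryPLGroup, (∀ x ≤ p, h x = e x) ∧ ∀ x, p ≤ x → h x = f x := by
  have hem : StrictMono e := he.1
  have hfm : StrictMono f := hf.1
  have hlow : ∀ x ≤ p, (if x ≤ p then e x else f x) = e x := fun x hx => if_pos hx
  have hhigh : ∀ x, p ≤ x → (if x ≤ p then e x else f x) = f x := fun x hx => by
    rcases hx.eq_or_lt with rfl | hx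
    · simpa using hp
    · exact if_neg hx.not_ge
  have hmono : StrictMono fun x => if x ≤ p then e x else f x := by
    intro a b hab
    dsimp only
    rcases le_total b p with hb | hb
    · rw [hlow b hb, hlow a (hab.le.trans hb)]
      exact hem hab
    rcases le_total p a with ha | ha
    · rw [hhigh b hb, hhigh a ha]
      exact hfm hab
    · rw [hlow a ha, hhigh b hb]
      have h1 := hem.monotone ha
      have h2 := hfm.monotone hb
      refine lt_of_le_of_ne (by linarith) fun h => ?_
      have h3 : a = p := hem.injective (by linarith)
      have h4 : b = p := hfm.injective (by linarith)
      linarith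
  have hsurj : Function.Surjective fun x => if x ≤ p then e x else f x := by
    intro w
    rcases le_total w (e p) with hw | hw
    · refine ⟨e⁻¹ w, ?_⟩
      dsimp only
      rw [hlow _ (hem.le_iff_le.1 (by simpa using hw))]
      simp
    · refine ⟨f⁻¹ w, ?_⟩
      dsimp only
      rw [hhigh _ (hfm.le_iff_le.1 (by simpa [← hp] using hw))]
      simp
  obtain ⟨S, hS, hSe⟩ := he.2
  obtain ⟨T, hT, hTf⟩ := hf.2
  refine ⟨Equiv.ofBijective _ ⟨hmono.injective, hsurj⟩, ⟨hmono, {p} ∪ (S ∪ T),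
    (finite_singleton p).union (hS.union hT), fun a b hab => ?_⟩, hlow, hhigh⟩
  simp only [disjoint_union_right, disjoint_singleton_right] at hab
  obtain ⟨hpab, haS, haT⟩ := hab
  by_cases hb : b ≤ p
  · obtain ⟨m, k, hm⟩ := hSe a b haS
    exact ⟨m, k, fun x hx => (hlow x (hx.2.trans hb)).trans (hm x hx)⟩
  · obtain ⟨m, k, hm⟩ := hTf a b haT
    have ha : p ≤ a := by
      by_contra! ha
      exact hpab ⟨ha, not_le.1 hb⟩
    exact ⟨m, k, fun x hx => (hhigh x (ha.trans hx.1)).trans (hm x hx)⟩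

theorem PLPlus.mem_finitaryPLGroup {e : Equiv.Perm ℝ} (he : PLPlus e) :
    e ∈ finitaryPLGroup := by
  obtain ⟨hmono, hout, n, t, ht, ht0, ht1, hpl⟩ := he
  refine ⟨hmono, range t, finite_range t, fun a b hab => ?_⟩
  have hmiss : ∀ i, a < t i → b ≤ t i := fun i hi => by
    by_contra! hb
    exact hab.le_bot ⟨⟨hi, hb⟩, mem_range_self i⟩
  by_cases h0 : b ≤ 0
  · exact ⟨1, 0, fun x hx => by
      rw [hout x fun h => by linarith [h.1, hx.2]]
      ring⟩
  by_cases h1 : 1 ≤ a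
  · exact ⟨1, 0, fun x hx => by
      rw [hout x fun h => by linarith [h.2, hx.1]]
      ring⟩
  push Not at h0 h1
  have ha0 : t 0 ≤ a := by
    by_contra! h
    linarith [hmiss 0 h]
  have hstep : ∀ i : Fin (n + 1), a < t i → ∃ j : Fin n, t j.castSucc ≤ a ∧ a < t j.succ := by
    intro i
    induction i using Fin.induction with
    | zero => exact fun h => absurd h ha0.not_gt
    | succ i ih =>
      intro h
      by_cases hi : a < t i.castSucc
      · exact ih hi
      · exact ⟨i, not_lt.1 hi, h⟩
  obtain ⟨j, hj, hj'⟩ := hstep (Fin.last n) (by rwa [ht1])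
  obtain ⟨m, k, hm⟩ := hpl j
  exact ⟨m, k, fun x hx => hm x ⟨hj.trans hx.1, hx.2.trans (hmiss _ hj')⟩⟩

theorem piecewiseLinearOn_of_mem_finitaryPLGroup {e : Equiv.Perm ℝ}
    (he : e ∈ finitaryPLGroup) : PiecewiseLinearOn e := by
  obtain ⟨-, S, hS, hSe⟩ := he
  let F : Finset ℝ := insert 0 (insert 1 (hS.toFinset.filter (· ∈ Ioo (0 : ℝ) 1)))
  have hF : ∀ x, x ∈ F ↔ x = 0 ∨ x = 1 ∨ x ∈ S ∧ x ∈ Ioo (0 : ℝ) 1 := fun x => by simp [F]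
  have hF01 : ∀ x ∈ F, 0 ≤ x ∧ x ≤ 1 := fun x hx => by
    rcases (hF x).1 hx with rfl | rfl | ⟨-, h⟩
    · norm_num
    · norm_num
    · exact ⟨h.1.le, h.2.le⟩
  have hpos : 0 < F.card := Finset.card_pos.2 ⟨0, (hF 0).2 (Or.inl rfl)⟩
  obtain ⟨n, hn⟩ : ∃ n, F.card = n + 1 := ⟨F.card - 1, by omega⟩
  let t := F.orderEmbOfFin hn
  have htF : ∀ i, t i ∈ F := F.orderEmbOfFin_mem hn
  have hrange : ∀ x ∈ F, ∃ i, t i = x := fun x hx => by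
    have := F.range_orderEmbOfFin hn
    exact (Set.ext_iff.1 this x).2 hx
  refine ⟨n, t, t.strictMono, ?_, ?_, fun i => hSe _ _ ?_⟩
  · obtain ⟨i, hi⟩ := hrange 0 ((hF 0).2 (Or.inl rfl))
    exact le_antisymm (hi ▸ t.monotone (Fin.zero_le i)) (hF01 _ (htF 0)).1
  · obtain ⟨i, hi⟩ := hrange 1 ((hF 1).2 (Or.inr (Or.inl rfl)))
    exact le_antisymm (hF01 _ (htF _)).2 (hi ▸ t.monotone (Fin.le_last i))
  · rw [Set.disjoint_left]
    rintro x ⟨hx1, hx2⟩ hxS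
    have h0 := (hF01 _ (htF i.castSucc)).1
    have h1 := (hF01 _ (htF i.succ)).2
    obtain ⟨j, rfl⟩ := hrange x ((hF x).2 (Or.inr (Or.inr ⟨hxS, by linarith, by linarith⟩)))
    have h2 := t.lt_iff_lt.1 hx1
    have h3 := t.lt_iff_lt.1 hx2
    rw [Fin.lt_def] at h2 h3
    simp only [Fin.val_castSucc, Fin.val_succ] at h2 h3
    omega

theorem PiecewiseLinearOn.exists_affine_near_one {f : ℝ → ℝ} (hf : PiecewiseLinearOn f)
    (h1 : f 1 = 1) :
    ∃ δ > (0 : ℝ), ∃ r, ∀ t ∈ Icc (1 - δ) (1 : ℝ), 1 - f t = r * (1 - t) := by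
  obtain ⟨n, t, ht, ht0, ht1, hpl⟩ := hf
  cases n with
  | zero =>
    have : t 0 = t (Fin.last 0) := rfl
    linarith
  | succ n =>
    obtain ⟨a, b, hab⟩ := hpl (Fin.last n)
    have hlt := ht (Fin.castSucc_lt_succ (i := Fin.last n))
    rw [Fin.succ_last, ht1] at hlt hab
    refine ⟨1 - t (Fin.last n).castSucc, by linarith, a, fun x hx => ?_⟩
    have e1 := hab 1 ⟨hlt.le, le_rfl⟩
    have e2 := hab x ⟨by linarith [hx.1], hx.2⟩
    linarith

theorem pow_apply_eq_pow_mul {f : Equiv.Perm ℝ} {c α : ℝ} (hc : c ∈ Ioo (0 : ℝ) 1)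
    (hf : ∀ t ∈ Icc (0 : ℝ) α, f t = c * t) (n : ℕ) :
    ∀ t ∈ Icc (0 : ℝ) α, (f ^ n) t = c ^ n * t := by
  induction n with
  | zero => simp
  | succ n ih =>
    intro t ht
    rw [pow_succ, Equiv.Perm.mul_apply, hf t ht, ih, pow_succ, mul_assoc]
    exact ⟨mul_nonneg hc.1.le ht.1, by nlinarith [hc.2, ht.1, ht.2]⟩

theorem one_sub_inv_pow_apply {f : Equiv.Perm ℝ} {c β : ℝ} (hc : 1 < c)
    (hf : ∀ t ∈ Icc β (1 : ℝ), 1 - f t = c * (1 - t)) (n : ℕ) :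
    ∀ t ∈ Icc β (1 : ℝ), c ^ n * (1 - (f⁻¹ ^ n) t) = 1 - t := by
  have hc0 : 0 < c := by linarith
  induction n with
  | zero => simp
  | succ n ih =>
    intro t ht
    have hdiv : (1 - t) / c ≤ 1 - t := div_le_self (by linarith [ht.2]) hc.le
    have hdiv0 : 0 ≤ (1 - t) / c := div_nonneg (by linarith [ht.2]) hc0.le
    have hw : 1 - (1 - t) / c ∈ Icc β (1 : ℝ) := ⟨by linarith [ht.1], by linarith⟩
    have hinv : f⁻¹ t = 1 - (1 - t) / c := by
      rw [Equiv.Perm.inv_eq_iff_eq]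
      have := hf _ hw
      have h2 : c * ((1 - t) / c) = 1 - t := by field_simp
      simp only [sub_sub_cancel] at this
      linarith
    rw [pow_succ f⁻¹, Equiv.Perm.mul_apply, hinv, pow_succ', mul_assoc, ih _ hw]
    field_simp
    ring

theorem exists_pow_mul_le {c ε : ℝ} (hc : c ∈ Ioo (0 : ℝ) 1) (hε : 0 < ε) :
    ∃ n : ℕ, ∀ t ∈ Icc (0 : ℝ) 1, c ^ n * t ≤ ε := by
  obtain ⟨n, hn⟩ := exists_pow_lt_of_lt_one hε hc.2
  refine ⟨n, fun t ht => ?_⟩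
  have := pow_pos hc.1 n
  nlinarith [ht.1, ht.2]

/-- stair algorithm, conjugacy criterion: with initial box `[0,α]²`
(slope `c`), final box `[β,1]²` (slope `c'`), target initial slope `q ∈ (0,1)`, and
`N` large enough that `z^{-N}(α) > β` and `y^{-N}(q·α) > β`, the candidate conjugator
`g` — equal to `y^{-N}(q · z^N(t))` on `[0, z^{-N}(α)]` and affine from
`(z^{-N}(α), y^{-N}(q·α))` to `(1,1)` on `[z^{-N}(α), 1]` — is a conjugator iff some
conjugator with initial slope `q` exists, and any such conjugator equals `g`. -/
theorem stair_algorithm_criterion (y z : Equiv.Perm ℝ) (α β c c' q : ℝ) (N : ℕ)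
    (g : ℝ → ℝ)
    (hy : PLPlusBelow y) (hz : PLPlusBelow z)
    (hα : α ∈ Ioo (0 : ℝ) 1) (hc : c ∈ Ioo (0 : ℝ) 1)
    (hβ : β ∈ Ioo (0 : ℝ) 1) (hc' : 1 < c')
    (hq : q ∈ Ioo (0 : ℝ) 1)
    (hinit : ∀ t ∈ Icc (0 : ℝ) α, y t = c * t ∧ z t = c * t)
    (hfin : ∀ t ∈ Icc β (1 : ℝ), 1 - y t = c' * (1 - t) ∧ 1 - z t = c' * (1 - t))
    (hN₁ : β < (z⁻¹ ^ N) α) (hN₂ : β < (y⁻¹ ^ N) (q * α))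
    (hgdef₁ : ∀ t ∈ Icc (0 : ℝ) ((z⁻¹ ^ N) α), g t = (y⁻¹ ^ N) (q * (z ^ N) t))
    (hgdef₂ : ∀ t ∈ Icc ((z⁻¹ ^ N) α) (1 : ℝ),
        g t = (y⁻¹ ^ N) (q * α) +
          (1 - (y⁻¹ ^ N) (q * α)) / (1 - (z⁻¹ ^ N) α) * (t - (z⁻¹ ^ N) α)) :
    ((∃ h : Equiv.Perm ℝ, PLPlus h ∧ InitialSlope (⇑h) q ∧ h⁻¹ * y * h = z) ↔
      (∀ t ∈ Icc (0 : ℝ) 1, g (z t) = y (g t))) ∧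
    (∀ h : Equiv.Perm ℝ, PLPlus h → InitialSlope (⇑h) q → h⁻¹ * y * h = z →
      ∀ t ∈ Icc (0 : ℝ) 1, h t = g t) := by
  have h1β : ((z⁻¹ ^ N) α) < 1 := by
    have hm : StrictMono (z⁻¹ ^ N : Equiv.Perm ℝ) :=
      (pow_mem (inv_mem hz.1.mem_finitaryPLGroup) N).1
    have h1 : (z⁻¹ ^ N : Equiv.Perm ℝ) 1 = 1 :=
      Equiv.Perm.pow_apply_eq_self_of_apply_eq_self
        (Equiv.Perm.inv_eq_iff_eq.2 (hz.1.2.1 1 (by simp)).symm) N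
    exact (hm hα.2).trans_eq h1
  have hqα : q * α < α := by nlinarith [hα.1, hq.2]
  have h1y : ((y⁻¹ ^ N) (q * α)) < 1 := by
    have hm : StrictMono (y⁻¹ ^ N : Equiv.Perm ℝ) :=
      (pow_mem (inv_mem hy.1.mem_finitaryPLGroup) N).1
    have h1 : (y⁻¹ ^ N : Equiv.Perm ℝ) 1 = 1 :=
      Equiv.Perm.pow_apply_eq_self_of_apply_eq_self
        (Equiv.Perm.inv_eq_iff_eq.2 (hy.1.2.1 1 (by simp)).symm) N
    exact (hm (hqα.trans hα.2)).trans_eq h1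
  have hzN : (z ^ N) ((z⁻¹ ^ N) α) = α := by simp
  have hmapz : ∀ t ∈ Icc (0 : ℝ) 1, z t ∈ Icc (0 : ℝ) 1 := fun t ht => by
    have h0 := hz.1.1.monotone ht.1
    have h1 := hz.1.1.monotone ht.2
    rw [hz.1.2.1 0 (by simp)] at h0
    rw [hz.1.2.1 1 (by simp)] at h1
    exact ⟨h0, h1⟩
  have hyα := pow_apply_eq_pow_mul hc fun t ht => (hinit t ht).1
  have hzα := pow_apply_eq_pow_mul hc fun t ht => (hinit t ht).2
  have hyβ := one_sub_inv_pow_apply hc' fun t ht => (hfin t ht).1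
  have hzβ := one_sub_inv_pow_apply hc' fun t ht => (hfin t ht).2
  have hscale : ∀ t ∈ Icc (0 : ℝ) α, q * t ∈ Icc (0 : ℝ) α := fun t ht =>
    ⟨mul_nonneg hq.1.le ht.1, by nlinarith [hq.1, hq.2, ht.1, ht.2]⟩
  have hunique : ∀ h : Equiv.Perm ℝ, PLPlus h → InitialSlope (⇑h) q → h⁻¹ * y * h = z →
      ∀ t ∈ Icc (0 : ℝ) 1, h t = g t := by
    rintro h ⟨hmono, hout, hpl⟩ ⟨-, ε, hε, hslope⟩ hconj
    have hsemi : SemiconjBy h z y := by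
      rw [SemiconjBy, ← hconj]
      group
    have hpow : ∀ (n : ℕ) t, h ((z ^ n) t) = (y ^ n) (h t) := fun n t =>
      Equiv.ext_iff.1 (hsemi.pow_right n) t
    have hpow' : ∀ (n : ℕ) t, h ((z⁻¹ ^ n) t) = (y⁻¹ ^ n) (h t) := fun n t =>
      Equiv.ext_iff.1 (hsemi.inv_right.pow_right n) t
    have hbox : ∀ t ∈ Icc (0 : ℝ) α, h t = q * t := fun t ht => by
      obtain ⟨n, hn⟩ := exists_pow_mul_le hc hε
      apply (y ^ n).injective
      rw [← hpow, hzα n t ht, hyα n _ (hscale t ht),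
        hslope _ ⟨mul_nonneg (pow_pos hc.1 n).le ht.1, hn t ⟨ht.1, ht.2.trans hα.2.le⟩⟩]
      ring
    have hp : h ((z⁻¹ ^ N) α) = (y⁻¹ ^ N) (q * α) := by
      rw [hpow', hbox α ⟨hα.1.le, le_rfl⟩]
    obtain ⟨δ, hδ, r, hr⟩ := hpl.exists_affine_near_one (hout 1 (by simp))
    have hlast : ∀ t ∈ Icc ((z⁻¹ ^ N) α) (1 : ℝ), 1 - h t = r * (1 - t) := fun t ht => by
      have htβ : t ∈ Icc β (1 : ℝ) := ⟨hN₁.le.trans ht.1, ht.2⟩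
      have hhβ : h t ∈ Icc β (1 : ℝ) := by
        have h0 := hmono.monotone ht.1
        have h1 := hmono.monotone ht.2
        rw [hp] at h0
        rw [hout 1 (by simp)] at h1
        exact ⟨hN₂.le.trans h0, h1⟩
      obtain ⟨n, hn⟩ := exists_pow_mul_le
        ⟨inv_pos.2 (by linarith : 0 < c'), inv_lt_one_of_one_lt₀ hc'⟩ hδ
      have hcn : 0 < c' ^ n := pow_pos (by linarith) n
      have e1 := hzβ n t htβ
      have e2 := hyβ n _ hhβ
      have e3 : 1 - (z⁻¹ ^ n) t = c'⁻¹ ^ n * (1 - t) := by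
        rw [← e1, inv_pow c', inv_mul_cancel_left₀ hcn.ne']
      have e4 := hn (1 - t) ⟨by linarith [ht.2], by linarith [htβ.1, hβ.1]⟩
      have e5 : 0 ≤ 1 - (z⁻¹ ^ n) t := by
        by_contra! hneg
        nlinarith [mul_neg_of_pos_of_neg hcn hneg, ht.2]
      have e6 := hr ((z⁻¹ ^ n) t) ⟨by linarith, by linarith⟩
      rw [hpow'] at e6
      rw [← e2, e6, ← e1]
      ring
    intro t ht
    rcases le_total t ((z⁻¹ ^ N) α) with htp | htp
    · rw [hgdef₁ t ⟨ht.1, htp⟩]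
      have hzt : (z ^ N) t ∈ Icc (0 : ℝ) α := by
        have hm : StrictMono (z ^ N : Equiv.Perm ℝ) := (pow_mem hz.1.mem_finitaryPLGroup N).1
        have h0 := hm.monotone ht.1
        rw [hzα N 0 ⟨le_rfl, hα.1.le⟩, mul_zero] at h0
        exact ⟨h0, (hm.monotone htp).trans_eq hzN⟩
      rw [← hbox _ hzt, hpow]
      simp
    · rw [hgdef₂ t ⟨htp, ht.2⟩]
      have e1 := hlast _ ⟨le_rfl, h1β.le⟩
      have e2 := hlast t ⟨htp, ht.2⟩
      rw [hp] at e1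
      have hne : 1 - (z⁻¹ ^ N) α ≠ 0 := by linarith
      rw [e1, mul_div_cancel_right₀ _ hne]
      linarith
  refine ⟨⟨?_, fun hg => ?_⟩, hunique⟩
  · rintro ⟨h, hh, hslope, hconj⟩ t ht
    rw [← hunique h hh hslope hconj t ht, ← hunique h hh hslope hconj _ (hmapz t ht), ← hconj]
    simp
  · have hp0 : 0 < (z⁻¹ ^ N) α := hβ.1.trans hN₁
    have hyN : (y⁻¹ ^ N) ((y ^ N) 0) = 0 := by simp
    rw [hyα N 0 ⟨le_rfl, hα.1.le⟩, mul_zero] at hyN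
    obtain ⟨s, hs, hs_apply⟩ := exists_mem_finitaryPLGroup_affine q 0 hq.1
    obtain ⟨v, hv, hv_apply⟩ := exists_mem_finitaryPLGroup_affine
      ((1 - (y⁻¹ ^ N) (q * α)) / (1 - (z⁻¹ ^ N) α))
      ((y⁻¹ ^ N) (q * α) -
        (1 - (y⁻¹ ^ N) (q * α)) / (1 - (z⁻¹ ^ N) α) * (z⁻¹ ^ N) α)
      (div_pos (by linarith) (by linarith))
    have hu : y⁻¹ ^ N * s * z ^ N ∈ finitaryPLGroup :=
      mul_mem (mul_mem (pow_mem (inv_mem hy.1.mem_finitaryPLGroup) N) hs)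
        (pow_mem hz.1.mem_finitaryPLGroup N)
    have hu_apply : ∀ t, (y⁻¹ ^ N * s * z ^ N) t = (y⁻¹ ^ N) (q * (z ^ N) t) := fun t => by
      simp [hs_apply]
    obtain ⟨h₁, hh₁, hlow₁, hhigh₁⟩ := exists_mem_finitaryPLGroup_glue
      finitaryPLGroup.one_mem hu (p := 0) (by
        rw [hu_apply, hzα N 0 ⟨le_rfl, hα.1.le⟩, mul_zero, mul_zero, hyN]
        rfl)
    obtain ⟨h₂, hh₂, hlow₂, hhigh₂⟩ := exists_mem_finitaryPLGroup_glue hh₁ hv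
      (p := (z⁻¹ ^ N) α) (by
        rw [hhigh₁ _ hp0.le, hu_apply, hzN, hv_apply]
        ring)
    obtain ⟨h, hh, hlow, hhigh⟩ := exists_mem_finitaryPLGroup_glue hh₂
      finitaryPLGroup.one_mem (p := 1) (by
        rw [hhigh₂ 1 h1β.le, hv_apply]
        have hne : 1 - (z⁻¹ ^ N) α ≠ 0 := by linarith
        rw [Equiv.Perm.one_apply]
        field_simp
        ring)
    have hout : ∀ t : ℝ, t ∉ Ioo (0 : ℝ) 1 → h t = t := fun t ht => by
      rcases le_or_gt t 0 with h0 | h0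
      · rw [hlow t (by linarith), hlow₂ t (by linarith), hlow₁ t h0]
        rfl
      · rw [hhigh t (by
          by_contra! h1
          exact ht ⟨h0, h1⟩)]
        rfl
    have hhg : ∀ t ∈ Icc (0 : ℝ) 1, h t = g t := fun t ht => by
      rw [hlow t ht.2]
      rcases le_total t ((z⁻¹ ^ N) α) with htp | htp
      · rw [hlow₂ t htp, hhigh₁ t ht.1, hu_apply, hgdef₁ t ⟨ht.1, htp⟩]
      · rw [hhigh₂ t htp, hv_apply, hgdef₂ t ⟨htp, ht.2⟩]
        ring
    refine ⟨h, ⟨hh.1, hout, piecewiseLinearOn_of_mem_finitaryPLGroup hh⟩,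
      ⟨hq.1, min α ((z⁻¹ ^ N) α), lt_min hα.1 hp0, fun t ht => ?_⟩, ?_⟩
    · have htα : t ∈ Icc (0 : ℝ) α := ⟨ht.1, ht.2.trans (min_le_left _ _)⟩
      have htp := ht.2.trans (min_le_right _ _)
      rw [hhg t ⟨ht.1, htp.trans h1β.le⟩, hgdef₁ t ⟨ht.1, htp⟩, hzα N t htα, inv_pow,
        Equiv.Perm.inv_eq_iff_eq, hyα N _ (hscale t htα)]
      ring
    · ext t
      rw [Equiv.Perm.mul_apply, Equiv.Perm.mul_apply, Equiv.Perm.inv_eq_iff_eq]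
      by_cases ht : t ∈ Icc (0 : ℝ) 1
      · rw [hhg t ht, hhg _ (hmapz t ht), hg t ht]
      · have ht' : t ∉ Ioo (0 : ℝ) 1 := fun h' => ht (Ioo_subset_Icc_self h')
        rw [hz.1.2.1 t ht', hout t ht', hy.1.2.1 t ht']
end

section
/- Let z ∈ PL₊^>(I) be a one-bump function and let C(z) = { g ∈ PL₊(I) : g ∘ z = z ∘ g } be its centralizer in PL₊(I). Then the map φ_z : C(z) → (ℝ_{>0}, ·) sending g to its initial slope g'(0) is an injective group homomorphism; equivalently, g ↦ log g'(0) is an injective homomorphism from C(z) to (ℝ, +). -/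
open Set

theorem PLPlus.exists_initialSlope {g : Equiv.Perm ℝ} (hg : PLPlus g) :
    ∃ q, InitialSlope (⇑g) q := by
  obtain ⟨hmono, hfix, n, t, ht, ht0, ht1, haff⟩ := hg
  obtain _ | n := n
  · have h : (0 : ℝ) = 1 := ht0.symm.trans ht1
    norm_num at h
  obtain ⟨a, b, hab⟩ := haff 0
  have hpos : 0 < t (Fin.succ 0) := ht0 ▸ ht (Fin.succ_pos 0)
  rw [Fin.castSucc_zero, ht0] at hab
  have hg0 : g 0 = 0 := hfix 0 (by simp)
  have hb : b = 0 := by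
    have := hab 0 (left_mem_Icc.2 hpos.le)
    simp_all
  have hat : 0 < a * t (Fin.succ 0) := by
    have h1 := hab _ (right_mem_Icc.2 hpos.le)
    have h2 := hmono hpos
    rwa [h1, hg0, hb, add_zero] at h2
  exact ⟨a, pos_of_mul_pos_left hat hpos.le, _, hpos, fun x hx => by rw [hab x hx, hb, add_zero]⟩

theorem InitialSlope.unique {f : ℝ → ℝ} {q r : ℝ} (hq : InitialSlope f q)
    (hr : InitialSlope f r) : q = r := by
  obtain ⟨-, ε, hε, h⟩ := hq
  obtain ⟨-, δ, hδ, k⟩ := hr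
  have hm : 0 < min ε δ := lt_min hε hδ
  have h1 := h _ ⟨hm.le, min_le_left _ _⟩
  have h2 := k _ ⟨hm.le, min_le_right _ _⟩
  exact mul_right_cancel₀ hm.ne' (h1.symm.trans h2)

theorem InitialSlope.comp {f g : ℝ → ℝ} {q r : ℝ} (hf : InitialSlope f q)
    (hg : InitialSlope g r) : InitialSlope (f ∘ g) (q * r) := by
  obtain ⟨hq, ε, hε, h⟩ := hf
  obtain ⟨hr, δ, hδ, k⟩ := hg
  refine ⟨mul_pos hq hr, min δ (ε / r), lt_min hδ (div_pos hε hr), fun t ht => ?_⟩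
  have h1 : t * r ≤ ε := (le_div_iff₀ hr).1 (ht.2.trans (min_le_right _ _))
  rw [Function.comp_apply, k t ⟨ht.1, ht.2.trans (min_le_left _ _)⟩,
    h _ ⟨mul_nonneg hr.le ht.1, by linarith⟩, mul_assoc]

/-- Two elements of the centralizer of a one-bump function with the same initial slope agree:
the set where they differ is invariant under `z⁻¹`, which is incompatible with its infimum being
an interior point. -/
theorem PLPlusAbove.eq_of_initialSlope_eq {z g h : Equiv.Perm ℝ} (hz : PLPlusAbove z)
    (hg : PLPlus g) (hgz : g * z = z * g) (hh : PLPlus h) (hhz : h * z = z * h) {q : ℝ}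
    (hgq : InitialSlope (⇑g) q) (hhq : InitialSlope (⇑h) q) : g = h := by
  obtain ⟨-, ε, hε, hgε⟩ := hgq
  obtain ⟨-, δ, hδ, hhδ⟩ := hhq
  obtain ⟨⟨hzm, hzfix, -⟩, hzlt⟩ := hz
  by_contra hne
  obtain ⟨t, ht⟩ : ∃ t, g t ≠ h t := by
    by_contra! H
    exact hne (Equiv.ext H)
  let S : Set ℝ := {s | g s ≠ h s}
  have hS : ∀ s ∈ S, s ∈ Ioo (0 : ℝ) 1 := fun s hs => by
    by_contra H
    exact hs ((hg.2.1 s H).trans (hh.2.1 s H).symm)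
  have hlow : ∀ s ∈ S, min ε δ ≤ s := fun s hs => by
    by_contra! H
    have h0 := (hS s hs).1.le
    exact hs ((hgε s ⟨h0, (H.le.trans (min_le_left _ _))⟩).trans
      (hhδ s ⟨h0, (H.le.trans (min_le_right _ _))⟩).symm)
  have hbdd : BddBelow S := ⟨_, hlow⟩
  have hL : sInf S ∈ Ioo (0 : ℝ) 1 :=
    ⟨(lt_min hε hδ).trans_le (le_csInf ⟨t, ht⟩ hlow), (csInf_le hbdd ht).trans_lt (hS t ht).2⟩
  obtain ⟨s, hs, hsL⟩ := exists_lt_of_csInf_lt ⟨t, ht⟩ (hzlt _ hL)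
  obtain ⟨u, rfl⟩ := z.surjective s
  have hu : u ∈ S := fun H => hs <| by
    have h1 : g (z u) = z (g u) := DFunLike.congr_fun hgz u
    have h2 : h (z u) = z (h u) := DFunLike.congr_fun hhz u
    rw [h1, h2, H]
  exact (hzm.lt_iff_lt.1 hsL).not_ge (csInf_le hbdd hu)

/-- for a one-bump `z ∈ PL₊^>(I)`, the map sending an element of the
centralizer `C(z) = {g ∈ PL₊(I) : g ∘ z = z ∘ g}` to its initial slope is an injective
group homomorphism `C(z) → (ℝ_{>0}, ·)`. -/
theorem centralizer_initial_slope_injective_hom (z : Equiv.Perm ℝ)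
    (hz : PLPlusAbove z) :
    ∃ φ : Equiv.Perm ℝ → ℝ,
      (∀ g : Equiv.Perm ℝ, PLPlus g → g * z = z * g →
        0 < φ g ∧ InitialSlope (⇑g) (φ g)) ∧
      (∀ g₁ g₂ : Equiv.Perm ℝ, PLPlus g₁ → g₁ * z = z * g₁ →
        PLPlus g₂ → g₂ * z = z * g₂ → φ (g₁ * g₂) = φ g₁ * φ g₂) ∧
      Set.InjOn φ {g : Equiv.Perm ℝ | PLPlus g ∧ g * z = z * g} := by
  let φ : Equiv.Perm ℝ → ℝ := fun g => Classical.epsilon (InitialSlope ⇑g)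
  have hφ : ∀ g : Equiv.Perm ℝ, (∃ q, InitialSlope (⇑g) q) → InitialSlope (⇑g) (φ g) :=
    fun g hg => Classical.epsilon_spec hg
  refine ⟨φ, fun g hg _ => ?_, fun g₁ g₂ h₁ _ h₂ _ => ?_, fun g₁ h₁ g₂ h₂ heq => ?_⟩
  · have h := hφ g hg.exists_initialSlope
    exact ⟨h.1, h⟩
  · have h : InitialSlope (⇑(g₁ * g₂)) (φ g₁ * φ g₂) :=
      (hφ g₁ h₁.exists_initialSlope).comp (hφ g₂ h₂.exists_initialSlope)
    exact (hφ _ ⟨_, h⟩).unique h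
  · exact hz.eq_of_initialSlope_eq h₁.1 h₁.2 h₂.1 h₂.2 (hφ g₁ h₁.1.exists_initialSlope)
      (heq ▸ hφ g₂ h₂.1.exists_initialSlope)
end

section
/- Let Z : ℝ → ℝ be a strictly increasing surjective piecewise-linear map (i.e. there is a discrete, closed set B ⊆ ℝ of breakpoints such that Z is affine on each connected component of ℝ \ B) satisfying Z(t+1) = Z(t) + 1 for all t ∈ ℝ, and suppose Z is not affine on all of ℝ. Then the set A = { a ∈ ℝ : there exists b ∈ ℝ with Z(t + a) = Z(t) + b for all t ∈ ℝ } is a subgroup of (ℝ, +) that is discrete: there exists ε > 0 such that A ∩ (−ε, ε) = {0}; in particular A is cyclic. -/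
open Set

/-- The shifts that preserve `f` up to an additive constant. -/
def shiftSymmetries {G H : Type*} [AddCommGroup G] [AddCommGroup H] (f : G → H) :
    AddSubgroup G where
  carrier := {a | ∃ b, ∀ t, f (t + a) = f t + b}
  zero_mem' := ⟨0, by simp⟩
  add_mem' := by
    rintro a a' ⟨b, hb⟩ ⟨b', hb'⟩
    exact ⟨b + b', fun t => by rw [← add_assoc, hb', hb, add_assoc]⟩
  neg_mem' := by
    rintro a ⟨b, hb⟩
    refine ⟨-b, fun t => ?_⟩
    have h := hb (t + -a)
    rw [neg_add_cancel_right] at h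
    rw [h, add_neg_cancel_right]

theorem mem_shiftSymmetries_iff_forall {G H : Type*} [AddCommGroup G] [AddCommGroup H]
    {f : G → H} {a : G} :
    a ∈ shiftSymmetries f ↔ ∀ t, f (t + a) = f t + (f a - f 0) := by
  refine ⟨fun ⟨b, hb⟩ t => ?_, fun h => ⟨_, h⟩⟩
  have h := hb 0
  rw [zero_add] at h
  rw [hb, h, add_sub_cancel_left]

theorem isClosed_shiftSymmetries {f : ℝ → ℝ} (hf : Continuous f) :
    IsClosed (shiftSymmetries f : Set ℝ) := by
  have h : (shiftSymmetries f : Set ℝ) = ⋂ t, {a | f (t + a) = f t + (f a - f 0)} := by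
    ext a
    simp only [SetLike.mem_coe, mem_shiftSymmetries_iff_forall, mem_iInter, mem_ofPred_eq]
  rw [h]
  exact isClosed_iInter fun t => isClosed_eq (by fun_prop) (by fun_prop)

/-- A continuous function all of whose shifts differ from it by a constant is affine. -/
theorem affine_of_shiftSymmetries_eq_top {f : ℝ → ℝ} (hf : Continuous f)
    (h : shiftSymmetries f = ⊤) : ∃ p q : ℝ, ∀ t, f t = p * t + q := by
  let g : ℝ →+ ℝ :=
    { toFun := fun t => f t - f 0
      map_zero' := sub_self _
      map_add' := fun s t => by
        have ht : t ∈ shiftSymmetries f := h ▸ AddSubgroup.mem_top t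
        rw [mem_shiftSymmetries_iff_forall.1 ht s]
        ring }
  have hg : Continuous g := hf.sub continuous_const
  refine ⟨g 1, f 0, fun t => ?_⟩
  have ht : g t = t * g 1 := by
    simpa using map_real_smul g hg t 1
  have hgt : g t = f t - f 0 := rfl
  linarith

/-- The shift symmetries of a continuous non-affine function form a cyclic group. -/
theorem exists_shiftSymmetries_eq_zmultiples {f : ℝ → ℝ} (hf : Continuous f)
    (h : ¬ ∃ p q : ℝ, ∀ t, f t = p * t + q) :
    ∃ a, shiftSymmetries f = AddSubgroup.zmultiples a := by
  rcases AddSubgroup.dense_or_cyclic (shiftSymmetries f) with hd | ⟨a, ha⟩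
  · refine absurd (affine_of_shiftSymmetries_eq_top hf ?_) h
    exact SetLike.coe_injective (by
      simpa [(isClosed_shiftSymmetries hf).closure_eq] using hd.closure_eq)
  · exact ⟨a, by rw [ha, AddSubgroup.zmultiples_eq_closure]⟩

/-- a strictly increasing surjective piecewise-linear map `Z : ℝ → ℝ`
(with a closed discrete set `B` of breakpoints) satisfying `Z(t+1) = Z(t)+1` and not
globally affine has a discrete group of "diagonal shift" symmetries
`A = {a : ∃ b, ∀ t, Z(t+a) = Z(t)+b}`; in particular `A` is cyclic. -/
theorem shift_symmetries_discrete_cyclic (Z : ℝ → ℝ) (B : Set ℝ) (A : Set ℝ)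
    (hmono : StrictMono Z) (hsurj : Function.Surjective Z)
    (hBclosed : IsClosed B)
    (hBdiscrete : ∀ x ∈ B, ∃ ε > (0 : ℝ), B ∩ Ioo (x - ε) (x + ε) ⊆ {x})
    (hPL : ∀ a b : ℝ, a < b → Icc a b ∩ B = ∅ →
        ∃ p q : ℝ, ∀ x ∈ Icc a b, Z x = p * x + q)
    (hper : ∀ t : ℝ, Z (t + 1) = Z t + 1)
    (hnotaffine : ¬ ∃ p q : ℝ, ∀ t : ℝ, Z t = p * t + q)
    (hA : A = {a : ℝ | ∃ b : ℝ, ∀ t : ℝ, Z (t + a) = Z t + b}) :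
    (0 : ℝ) ∈ A ∧
    (∀ a ∈ A, -a ∈ A) ∧
    (∀ a ∈ A, ∀ a' ∈ A, a + a' ∈ A) ∧
    (∃ ε > (0 : ℝ), A ∩ Ioo (-ε) ε = {0}) ∧
    (∃ a₀ : ℝ, ∀ x : ℝ, x ∈ A ↔ ∃ n : ℤ, x = n * a₀) := by
  have hcont : Continuous Z := hmono.monotone.continuous_of_surjective hsurj
  obtain ⟨a₀, ha₀⟩ := exists_shiftSymmetries_eq_zmultiples hcont hnotaffine
  have hAS : A = shiftSymmetries Z := hA
  have hmem (x : ℝ) : x ∈ A ↔ ∃ n : ℤ, x = n * a₀ := by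
    rw [hAS, SetLike.mem_coe, ha₀, AddSubgroup.mem_zmultiples_iff]
    simp only [zsmul_eq_mul, eq_comm]
  have h0 : (0 : ℝ) ∈ A := hAS ▸ zero_mem (shiftSymmetries Z)
  have ha₀_ne : a₀ ≠ 0 := by
    rintro rfl
    have h1 : (1 : ℝ) ∈ A := hA ▸ ⟨1, hper⟩
    simp [hmem] at h1
  refine ⟨h0, ?_, ?_, ⟨|a₀|, abs_pos.2 ha₀_ne, ?_⟩, a₀, hmem⟩
  · rw [hAS]
    exact fun a ha => neg_mem ha
  · rw [hAS]
    exact fun a ha a' ha' => add_mem ha ha'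
  · refine Subset.antisymm ?_ (by simp [h0, ha₀_ne])
    rintro x ⟨hx, hxI⟩
    obtain ⟨n, rfl⟩ := (hmem x).1 hx
    have hlt : |(n : ℝ)| * |a₀| < 1 * |a₀| := by
      rw [← abs_mul, one_mul]
      exact abs_lt.2 hxI
    have hn : |n| < 1 := by exact_mod_cast lt_of_mul_lt_mul_right hlt (abs_nonneg a₀)
    simp [Int.abs_lt_one_iff.1 hn]
end
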